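/- arXiv:1207.2981 — 3 statements merged into one kernel-verified Lean document; each statement's English description precedes it below -/
import Mathlib

section
/- Let G ∈ ℝ^{q×q} be a deadbeat coupling matrix and let Q ∈ ℝ^{m×m} be arbitrary. Then the linear map γ : (ℝ^m)^q → (ℝ^m)^q given by 𝐲 ↦ (G ⊗ Q)𝐲 (Kronecker product) is a deadbeat interconnection: γ maps Y_0 into Y_0, and there exists an integer r ≥ 1 such that γ^r((ℝ^m)^q) ⊆ Y_0. -/
open Matrix Kronecker Polynomial

/-- `G ∈ ℝ^{q×q}` is a deadbeat coupling matrix: each row sums to 1 (so `λ = 1`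
is an eigenvalue with eigenvector `𝟙`) and all remaining eigenvalues lie at the
origin, i.e. the characteristic polynomial of `G` is `s^{q-1}(s-1)`. -/
def IsDeadbeatCoupling {q : ℕ} (G : Matrix (Fin q) (Fin q) ℝ) : Prop :=
  (∀ i, ∑ j, G i j = 1) ∧ G.charpoly = X ^ (q - 1) * (X - 1)

/-- Membership of `𝐲 ∈ (ℝ^m)^q` (vectorized over `Fin q × Fin m`) in
`Y₀ = {(y₁,…,y_q) : y₁ = ⋯ = y_q}`. -/
def InY0 {q m : ℕ} (y : Fin q × Fin m → ℝ) : Prop :=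
  ∀ i i' j, y (i, j) = y (i', j)

lemma deadbeat_fixed_const {q : ℕ} (G : Matrix (Fin q) (Fin q) ℝ) (hG : IsDeadbeatCoupling G)
    (x : Fin q → ℝ) (hx : G *ᵥ x = x) (i i' : Fin q) : x i = x i' := by
  obtain ⟨h1, h2⟩ := hG
  have hmult : (Matrix.toLin' G).charpoly.rootMultiplicity 1 ≤ 1 := by
    have hc : (Matrix.toLin' G).charpoly = G.charpoly := Matrix.charpoly_toLin' G
    rw [hc, h2]
    have hne : (X ^ (q - 1) * (X - 1) : ℝ[X]) ≠ 0 := by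
      rw [← h2]; exact (Matrix.charpoly_monic G).ne_zero
    rw [rootMultiplicity_mul hne]
    have a : rootMultiplicity (1 : ℝ) (X ^ (q - 1) : ℝ[X]) = 0 :=
      rootMultiplicity_eq_zero (by simp)
    have b : rootMultiplicity (1 : ℝ) (X - 1 : ℝ[X]) = 1 := by
      have := rootMultiplicity_X_sub_C_self (x := (1 : ℝ))
      simpa using this
    omega
  have hle := (LinearMap.finrank_eigenspace_le (Matrix.toLin' G) 1).trans hmult
  obtain ⟨v, hv⟩ := finrank_le_one_iff.1 hle
  obtain ⟨c, hc⟩ := hv ⟨x, by simp [Module.End.mem_eigenspace_iff, hx]⟩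
  obtain ⟨d, hd⟩ := hv ⟨fun _ => 1, by
    rw [Module.End.mem_eigenspace_iff]
    ext k
    simp [Matrix.mulVec, dotProduct, h1]⟩
  have hc' : ∀ k, c * (v : Fin q → ℝ) k = x k := fun k => congrFun (congrArg Subtype.val hc) k
  have hd' : ∀ k, d * (v : Fin q → ℝ) k = 1 := fun k => congrFun (congrArg Subtype.val hd) k
  have hd0 : d ≠ 0 := by
    rintro rfl
    simpa using hd' i
  have : (v : Fin q → ℝ) i = (v : Fin q → ℝ) i' :=
    mul_left_cancel₀ hd0 ((hd' i).trans (hd' i').symm)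
  rw [← hc', ← hc', this]

lemma deadbeat_pow {q : ℕ} (G : Matrix (Fin q) (Fin q) ℝ) (hG : IsDeadbeatCoupling G)
    (i i' j : Fin q) : (G ^ (q - 1 + 1)) i j = (G ^ (q - 1 + 1)) i' j := by
  have hch := Matrix.aeval_self_charpoly G
  rw [hG.2] at hch
  simp only [map_mul, map_pow, map_sub, aeval_X, map_one, mul_sub, mul_one, sub_eq_zero,
    ← pow_succ] at hch
  refine deadbeat_fixed_const G hG (fun k => (G ^ (q - 1 + 1)) k j) ?_ i i'
  have h : G * G ^ (q - 1 + 1) = G ^ (q - 1 + 1) := by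
    rw [hch, ← pow_succ', hch]
  ext k
  exact congrFun (congrFun h k) j

lemma kron_pow {q m : ℕ} (G : Matrix (Fin q) (Fin q) ℝ) (Q : Matrix (Fin m) (Fin m) ℝ) (n : ℕ) :
    (G ⊗ₖ Q) ^ n = (G ^ n) ⊗ₖ (Q ^ n) := by
  induction n with
  | zero => simp
  | succ n ih => rw [pow_succ, pow_succ, pow_succ, ih, Matrix.mul_kronecker_mul]

lemma iter_mulVec {ι : Type*} [Fintype ι] [DecidableEq ι] (A : Matrix ι ι ℝ) (n : ℕ) (y : ι → ℝ) :
    (fun w => A *ᵥ w)^[n] y = (A ^ n) *ᵥ y := by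
  induction n with
  | zero => simp
  | succ n ih => rw [Function.iterate_succ_apply', ih, pow_succ', Matrix.mulVec_mulVec]

/-- For a deadbeat coupling matrix `G` and arbitrary `Q`, the linear map
`𝐲 ↦ (G ⊗ Q)𝐲` is a deadbeat interconnection: it maps `Y₀` into `Y₀` and
some iterate `r ≥ 1` maps everything into `Y₀`. -/
theorem kronecker_deadbeat_interconnection {q m : ℕ}
    (G : Matrix (Fin q) (Fin q) ℝ) (hG : IsDeadbeatCoupling G)
    (Q : Matrix (Fin m) (Fin m) ℝ) :
    (∀ y : Fin q × Fin m → ℝ, InY0 y → InY0 ((G ⊗ₖ Q) *ᵥ y)) ∧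
    ∃ r : ℕ, 1 ≤ r ∧ ∀ y : Fin q × Fin m → ℝ,
      InY0 ((fun w => (G ⊗ₖ Q) *ᵥ w)^[r] y) := by
  refine ⟨?_, q - 1 + 1, by omega, ?_⟩
  · intro y hy i i' j
    have key : ∀ a : Fin q, ((G ⊗ₖ Q) *ᵥ y) (a, j) = ∑ l, Q j l * y (i, l) := by
      intro a
      simp only [Matrix.mulVec, dotProduct, Matrix.kroneckerMap_apply, Fintype.sum_prod_type]
      have : ∀ k : Fin q, ∑ l, G a k * Q j l * y (k, l) = G a k * ∑ l, Q j l * y (i, l) := by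
        intro k
        rw [Finset.mul_sum]
        refine Finset.sum_congr rfl fun l _ => ?_
        rw [hy k i l, mul_assoc]
      rw [Finset.sum_congr rfl fun k _ => this k, ← Finset.sum_mul, hG.1 a, one_mul]
    rw [key, key]
  · intro y i i' j
    rw [iter_mulVec, kron_pow]
    simp only [Matrix.mulVec, dotProduct, Matrix.kroneckerMap_apply]
    refine Finset.sum_congr rfl fun p _ => ?_
    rw [deadbeat_pow G hG i i' p.1]
end

section
/- Let f : ℝ³ → ℝ³ be given by f(a, b, c) = (b, c^{1/3}, a³ + b³) (real cube root) and h : ℝ³ → ℝ, h(a, b, c) = a, and let γ : ℝ^q → ℝ^q be γ_i(y_1,…,y_q) = (Σ_{j=1}^q γ_ij y_j³)^{1/3} where [γ_ij] ∈ ℝ^{q×q} is a deadbeat coupling matrix. Then the triple (f, h, γ) is compatible with p = 3: for every σ ≥ 1 and every (x_1,…,x_q) ∈ (ℝ³)^q, if (h(f^k(x_1)),…,h(f^k(x_q))) ∈ Y_σ for all k ∈ {0, 1, 2}, then (h(f³(x_1)),…,h(f³(x_q))) ∈ Y_σ. -/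
open Matrix Kronecker Polynomial

/-- The real cube root. -/
noncomputable def cbrt (t : ℝ) : ℝ := Real.sign t * |t| ^ ((1 : ℝ) / 3)

/-- The nonlinear coupling `γᵢ(𝐲) = (∑ⱼ γᵢⱼ yⱼ³)^{1/3}` (real cube root). -/
noncomputable def cubicCoupling {q : ℕ} (G : Matrix (Fin q) (Fin q) ℝ)
    (y : Fin q → ℝ) : Fin q → ℝ :=
  fun i => cbrt (∑ j, G i j * y j ^ 3)

/-- Membership in `Y₀`: all components of a `q`-tuple are equal. -/
def IsDiag {Y : Type*} {q : ℕ} (y : Fin q → Y) : Prop := ∀ i j, y i = y j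

/-- The example system `f(a,b,c) = (b, c^{1/3}, a³ + b³)`. -/
noncomputable def fEx (x : ℝ × ℝ × ℝ) : ℝ × ℝ × ℝ :=
  (x.2.1, cbrt x.2.2, x.1 ^ 3 + x.2.1 ^ 3)

/-- The example output map `h(a,b,c) = a`. -/
def hEx (x : ℝ × ℝ × ℝ) : ℝ := x.1

theorem cbrt_pow_three (t : ℝ) : cbrt t ^ 3 = t := by
  have h : (|t| ^ ((1 : ℝ) / 3)) ^ 3 = |t| := by
    rw [← Real.rpow_natCast, ← Real.rpow_mul (abs_nonneg t)]
    norm_num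
  unfold cbrt
  rw [mul_pow, h]
  rcases lt_trichotomy t 0 with ht | ht | ht
  · rw [Real.sign_of_neg ht, abs_of_neg ht]; ring
  · subst ht; simp
  · rw [Real.sign_of_pos ht, abs_of_pos ht]; ring

theorem iterate_cube {q : ℕ} (G : Matrix (Fin q) (Fin q) ℝ) (n : ℕ) (y : Fin q → ℝ) :
    (fun i => ((cubicCoupling G)^[n] y) i ^ 3) = (G ^ n) *ᵥ (fun i => y i ^ 3) := by
  induction n with
  | zero => simp
  | succ n ih =>
    rw [pow_succ', ← Matrix.mulVec_mulVec, ← ih]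
    funext i
    rw [Function.iterate_succ_apply']
    simp only [cubicCoupling, cbrt_pow_three, Matrix.mulVec, dotProduct]

theorem isDiag_iterate_iff {q : ℕ} (G : Matrix (Fin q) (Fin q) ℝ) (n : ℕ) (y : Fin q → ℝ) :
    IsDiag ((cubicCoupling G)^[n] y) ↔ IsDiag ((G ^ n) *ᵥ (fun i => y i ^ 3)) := by
  rw [← iterate_cube]
  have hinj : Function.Injective (fun t : ℝ => t ^ 3) :=
    (Odd.strictMono_pow (by decide : Odd 3)).injective
  exact forall₂_congr fun i j => (hinj.eq_iff (a := (cubicCoupling G)^[n] y i)).symm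

/-- The triple `(f, h, γ)` of the example is compatible with `p = 3`: for every
`σ ≥ 1` and `(x₁,…,x_q)`, if `(h(f^k(x₁)),…,h(f^k(x_q))) ∈ Y_σ` for
`k ∈ {0,1,2}` then `(h(f³(x₁)),…,h(f³(x_q))) ∈ Y_σ`, where
`Y_σ = {𝐲 : γ^σ(𝐲) ∈ Y₀}`. -/
theorem example_compatible {q : ℕ}
    (G : Matrix (Fin q) (Fin q) ℝ) (hG : IsDeadbeatCoupling G) :
    ∀ σ, 1 ≤ σ → ∀ x : Fin q → ℝ × ℝ × ℝ,
      (∀ k < 3, IsDiag ((cubicCoupling G)^[σ] fun i => hEx (fEx^[k] (x i)))) →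
      IsDiag ((cubicCoupling G)^[σ] fun i => hEx (fEx^[3] (x i))) := by
  intro σ _ x hx
  have h0 := (isDiag_iterate_iff G σ _).1 (hx 0 (by norm_num))
  have h1 := (isDiag_iterate_iff G σ _).1 (hx 1 (by norm_num))
  rw [isDiag_iterate_iff]
  have e : (fun i => hEx (fEx^[3] (x i)) ^ 3)
      = (fun i => hEx (fEx^[0] (x i)) ^ 3) + (fun i => hEx (fEx^[1] (x i)) ^ 3) := by
    funext i
    simp [hEx, fEx, cbrt_pow_three]
  rw [e, Matrix.mulVec_add]
  intro i j
  rw [Pi.add_apply, Pi.add_apply, h0 i j, h1 i j]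
end

section
/- Suppose f : X → X is bijective, there exists an integer p ≥ 1 such that [x̂]_{p−2}^+ ∩ h⁻¹(y) is a singleton for all x̂ ∈ X and y ∈ Y, γ : Y^q → Y^q is a deadbeat interconnection with deadbeat horizon r, and the triple (f, h, γ) is compatible. Then the map Φ : X^q → X^q given by Φ(𝐱) = f([𝐱]_{p−2}^+ ∩ h⁻¹(γ(h(𝐱)))) (applied componentwise) is itself a deadbeat interconnection over X^q: Φ maps the diagonal {(x,…,x) : x ∈ X} ⊆ X^q into itself, and Φ^{rp}(X^q) is contained in the diagonal. -/
/-- `[x]_k`: `[x]_0 = h⁻¹(h x)`, `[x]_{k+1} = [x]_k⁺ ∩ [x]_0`, where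
`[x]_k⁺ = f([f⁻¹(x)]_k)` and `[S]_k = ⋃ z ∈ S, [z]_k`. -/
def obsSet {X Y : Type*} (f : X → X) (h : X → Y) : ℕ → X → Set X
  | 0, x => h ⁻¹' {h x}
  | k + 1, x => (f '' ⋃ z ∈ f ⁻¹' {x}, obsSet f h k z) ∩ h ⁻¹' {h x}

/-- `[x]_k⁺ := f([f⁻¹(x)]_k)`, with `f⁻¹` the set-valued inverse. -/
def obsSetPlus {X Y : Type*} (f : X → X) (h : X → Y) (k : ℕ) (x : X) : Set X :=
  f '' ⋃ z ∈ f ⁻¹' {x}, obsSet f h k z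

/-- `obsSetPlus' f h n x = [x]_{n-1}⁺`, with the convention `[x]_{-1}⁺ = X`
(so `[x]_{p-2}⁺ = obsSetPlus' f h (p-1) x` for `p ≥ 1`). -/
def obsSetPlus' {X Y : Type*} (f : X → X) (h : X → Y) : ℕ → X → Set X
  | 0, _ => Set.univ
  | n + 1, x => obsSetPlus f h n x
/-- `γ : Y^q → Y^q` is a deadbeat interconnection with deadbeat horizon `r ≥ 1`
if `γ(Y₀) ⊆ Y₀` and `γ^r(Y^q) ⊆ Y₀`. -/
def IsDeadbeatInterconnection {Y : Type*} {q : ℕ}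
    (γ : (Fin q → Y) → (Fin q → Y)) (r : ℕ) : Prop :=
  1 ≤ r ∧ (∀ y, IsDiag y → IsDiag (γ y)) ∧ ∀ y, IsDiag (γ^[r] y)

/-- The triple `(f, h, γ)` is compatible (with horizon `p`): for every `σ ≥ 1`
and `𝐱 ∈ X^q`, if `h(f^k(𝐱)) ∈ Y_σ` for `k = 0, …, p-1` then `h(f^p(𝐱)) ∈ Y_σ`,
where `Y_σ = {𝐲 : γ^σ(𝐲) ∈ Y₀}`. -/
def Compatible {X Y : Type*} {q : ℕ} (f : X → X) (h : X → Y)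
    (γ : (Fin q → Y) → (Fin q → Y)) (p : ℕ) : Prop :=
  ∀ σ, 1 ≤ σ → ∀ x : Fin q → X,
    (∀ k < p, IsDiag (γ^[σ] fun i => h (f^[k] (x i)))) →
    IsDiag (γ^[σ] fun i => h (f^[p] (x i)))

theorem mem_obsSet_iff {X Y : Type*} (f g : X → X) (h : X → Y)
    (hgf : ∀ x, g (f x) = x) (hfg : ∀ x, f (g x) = x) (k : ℕ) :
    ∀ x z, z ∈ obsSet f h k x ↔ ∀ j ≤ k, h (g^[j] z) = h (g^[j] x) := by
  induction k with
  | zero => intro x z; simp [obsSet]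
  | succ k ih =>
    intro x z
    simp only [obsSet, Set.mem_inter_iff, Set.mem_image, Set.mem_iUnion, Set.mem_preimage,
      Set.mem_singleton_iff, ih]
    constructor
    · rintro ⟨⟨a, ⟨b, rfl, hb⟩, rfl⟩, h0⟩ j hj
      cases j with
      | zero => exact h0
      | succ j =>
        simp only [Function.iterate_succ_apply, hgf]
        exact hb j (by omega)
    · intro H
      refine ⟨⟨g z, ⟨g x, hfg x, fun j hj => ?_⟩, hfg z⟩, H 0 (by omega)⟩
      simpa only [Function.iterate_succ_apply] using H (j + 1) (by omega)

theorem mem_obsSetPlus'_iff {X Y : Type*} (f g : X → X) (h : X → Y)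
    (hgf : ∀ x, g (f x) = x) (hfg : ∀ x, f (g x) = x) (n : ℕ) (x z : X) :
    z ∈ obsSetPlus' f h n x ↔ ∀ j < n, h (g^[j + 1] z) = h (g^[j + 1] x) := by
  cases n with
  | zero => simp [obsSetPlus']
  | succ k =>
    simp only [obsSetPlus', obsSetPlus, Set.mem_image, Set.mem_iUnion, Set.mem_preimage,
      Set.mem_singleton_iff, mem_obsSet_iff f g h hgf hfg]
    constructor
    · rintro ⟨a, ⟨b, rfl, hb⟩, rfl⟩ j hj
      simp only [Function.iterate_succ_apply, hgf]
      exact hb j (by omega)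
    · intro H
      refine ⟨g z, ⟨g x, hfg x, fun j hj => ?_⟩, hfg z⟩
      simpa only [Function.iterate_succ_apply] using H j (by omega)

/-- The map `Φ(𝐱) = f([𝐱]_{p-2}⁺ ∩ h⁻¹(γ(h(𝐱))))` (componentwise) is itself a
deadbeat interconnection over `X^q` with deadbeat horizon `rp`. -/
theorem Phi_deadbeat_interconnection {X Y : Type*} {q : ℕ} (f : X → X) (h : X → Y)
    (hf : Function.Bijective f) (hh : Function.Surjective h)
    (p : ℕ) (hp : 1 ≤ p)
    (hsing : ∀ (xh : X) (y : Y), ∃ z, obsSetPlus' f h (p - 1) xh ∩ h ⁻¹' {y} = {z})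
    (γ : (Fin q → Y) → (Fin q → Y)) (r : ℕ)
    (hγ : IsDeadbeatInterconnection γ r)
    (hcomp : Compatible f h γ p)
    (Φ : (Fin q → X) → (Fin q → X))
    (hΦ : ∀ (x : Fin q → X) (i : Fin q), Φ x i ∈
      f '' (obsSetPlus' f h (p - 1) (x i) ∩ h ⁻¹' {γ (fun j => h (x j)) i})) :
    (∀ x : Fin q → X, IsDiag x → IsDiag (Φ x)) ∧ ∀ x, IsDiag (Φ^[r * p] x) := by
  obtain ⟨g, hgf, hfg⟩ := Function.bijective_iff_has_inverse.mp hf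
  have mem := mem_obsSetPlus'_iff f g h hgf hfg
  obtain ⟨-, hγ0, hγr⟩ := hγ
  -- states are determined by the last `p` outputs
  have uniq : ∀ a b : X, (∀ j < p, h (g^[j] a) = h (g^[j] b)) → a = b := by
    intro a b hab
    obtain ⟨z, hz⟩ := hsing b (h b)
    have ha : a ∈ obsSetPlus' f h (p - 1) b ∩ h ⁻¹' {h b} :=
      ⟨(mem _ _ _).2 fun j hj => hab (j + 1) (by omega), hab 0 (by omega)⟩
    have hb : b ∈ obsSetPlus' f h (p - 1) b ∩ h ⁻¹' {h b} :=
      ⟨(mem _ _ _).2 fun j hj => rfl, rfl⟩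
    rw [hz] at ha hb
    exact ha.trans hb.symm
  have Φ1 : ∀ x i, h (g (Φ x i)) = γ (fun j => h (x j)) i := by
    intro x i
    obtain ⟨z, ⟨-, hz⟩, hzx⟩ := hΦ x i
    rw [← hzx, hgf]; exact hz
  have Φ2 : ∀ x i, ∀ j < p - 1, h (g^[j + 2] (Φ x i)) = h (g^[j + 1] (x i)) := by
    intro x i j hj
    obtain ⟨z, ⟨hz, -⟩, hzx⟩ := hΦ x i
    rw [← hzx, Function.iterate_succ_apply, hgf]
    exact (mem _ _ _).1 hz j hj
  have fin : ∀ x : Fin q → X,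
      (∀ j < p, IsDiag fun i => h (g^[j + 1] (x i))) → IsDiag x := by
    intro x H a b
    have : g (x a) = g (x b) := uniq _ _ fun j hj => by
      simpa only [Function.iterate_succ_apply] using H j hj a b
    rw [← hfg (x a), this, hfg]
  constructor
  · intro x hx
    apply fin
    intro j hj a b
    cases j with
    | zero =>
      simp only [zero_add, Function.iterate_one, Φ1]
      exact hγ0 _ (fun c d => by rw [hx c d]) a b
    | succ j =>
      have e1 := Φ2 x a j (by omega)
      have e2 := Φ2 x b j (by omega)
      show h (g^[j + 2] (Φ x a)) = h (g^[j + 2] (Φ x b))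
      rw [e1, e2, hx a b]
  · have fgit : ∀ (n : ℕ) (x : X), f^[n] (g^[n] x) = x := fun n x =>
      (Function.LeftInverse.iterate hfg n) x
    have fgk : ∀ (k n : ℕ) (x : X), f^[k] (g^[n + k] x) = g^[n] x := by
      intro k n x
      rw [add_comm, Function.iterate_add_apply, fgit]
    -- one step
    have step : ∀ σ m (x : Fin q → X),
        (∀ j < p, IsDiag (γ^[σ + 1] fun i => h (g^[j + 1] (x i)))) →
        (∀ j < p, j < m → IsDiag (γ^[σ] fun i => h (g^[j + 1] (x i)))) →
        (∀ j < p, IsDiag (γ^[σ + 1] fun i => h (g^[j + 1] (Φ x i)))) ∧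
        (∀ j < p, j < m + 1 → IsDiag (γ^[σ] fun i => h (g^[j + 1] (Φ x i)))) := by
      intro σ m x H1 H2
      have h0 : IsDiag (γ^[σ + 1] fun i => h (x i)) := by
        have := hcomp (σ + 1) (by omega) (fun i => g^[p] (x i)) (by
          intro k hk
          have e : ∀ i, f^[k] (g^[p] (x i)) = g^[(p - k - 1) + 1] (x i) := by
            intro i
            rw [← fgk k (p - k - 1 + 1) (x i)]
            congr 2; omega
          simp only [e]
          exact H1 _ (by omega))
        simpa only [fgit] using this
      have hz : IsDiag (γ^[σ] fun i => h (g (Φ x i))) := by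
        simp only [Φ1]
        simpa only [Function.iterate_succ_apply] using h0
      have key : ∀ j, j + 1 < p → (fun i => h (g^[j + 1 + 1] (Φ x i))) =
          fun i => h (g^[j + 1] (x i)) := fun j hj => by
        funext i; exact Φ2 x i j (by omega)
      constructor
      · intro j hj
        cases j with
        | zero => rw [Function.iterate_succ_apply']; exact hγ0 _ hz
        | succ j => rw [key j hj]; exact H1 j (by omega)
      · intro j hj hm
        cases j with
        | zero => exact hz
        | succ j => rw [key j hj]; exact H2 j (by omega) (by omega)
    have steps : ∀ σ (x : Fin q → X),
        (∀ j < p, IsDiag (γ^[σ + 1] fun i => h (g^[j + 1] (x i)))) → ∀ m,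
        (∀ j < p, IsDiag (γ^[σ + 1] fun i => h (g^[j + 1] (Φ^[m] x i)))) ∧
        (∀ j < p, j < m → IsDiag (γ^[σ] fun i => h (g^[j + 1] (Φ^[m] x i)))) := by
      intro σ x H m
      induction m with
      | zero => exact ⟨H, fun j _ hj => absurd hj (by omega)⟩
      | succ m ih =>
        rw [Function.iterate_succ_apply']
        exact step σ m _ ih.1 ih.2
    have main : ∀ σ (x : Fin q → X),
        (∀ j < p, IsDiag (γ^[σ] fun i => h (g^[j + 1] (x i)))) → IsDiag (Φ^[σ * p] x) := by
      intro σ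
      induction σ with
      | zero => intro x H; simpa using fin x H
      | succ σ ih =>
        intro x H
        rw [Nat.succ_mul, Function.iterate_add_apply]
        exact ih _ fun j hj => (steps σ x H p).2 j hj hj
    exact fun x => main r x fun j _ => hγr _
end
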